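/- arXiv:0902.2236 — 6 statements merged into one kernel-verified Lean document; each statement's English description precedes it below -/
import Mathlib

section
/- Let t ≥ 0 and y ≥ 0 be real numbers, and consider age-model customer data as below. Then ∑_{i=1}^N 1{t−τ̃_i ≤ y}·1{t < η̃_i} + ∑_{j=1}^K 1{τ_j ≤ t}·1{t−τ_j ≤ y}·1{t−τ_j < η_j} = ∑_{i=1}^N 1{−τ̃_i ≤ y} − ∑_{i=1}^N 1{η̃_i ≤ min(t, y+τ̃_i)} − ∑_{i=1}^N 1{y−t < −τ̃_i ≤ y}·1{η̃_i > y+τ̃_i} + ∑_{j=1}^K 1{τ_j ≤ t} − ∑_{j=1}^K 1{τ_j ≤ t}·1{η_j ≤ min(t−τ_j, y)} − ∑_{j=1}^K 1{τ_j < t−y}·1{η_j > y}. (This is Proposition 2.1 of the paper, the alternative representation of the number A_t(y) of customers in a G/GI/∞ queue at time t whose age is at most y, written with explicit index sets.) -/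
open Finset

/-- Proposition 2.1: alternative representation of the number `A_t(y)` of customers in a
`G/GI/∞` queue at time `t` whose age is at most `y`, written with explicit index sets. -/
theorem age_representation
    (N K : ℕ) (τt ηt : Fin N → ℝ) (τ η : Fin K → ℝ)
    (hτt : ∀ i, τt i ≤ 0) (hηt : ∀ i, 0 ≤ ηt i)
    (hτ : ∀ j, 0 ≤ τ j) (hη : ∀ j, 0 ≤ η j)
    (t y : ℝ) (ht : 0 ≤ t) (hy : 0 ≤ y) :
    (∑ i, (if t - τt i ≤ y then (1 : ℝ) else 0) * (if t < ηt i then (1 : ℝ) else 0))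
      + ∑ j, (if τ j ≤ t then (1 : ℝ) else 0) * (if t - τ j ≤ y then (1 : ℝ) else 0)
          * (if t - τ j < η j then (1 : ℝ) else 0)
    = (∑ i, (if -τt i ≤ y then (1 : ℝ) else 0))
      - (∑ i, (if ηt i ≤ min t (y + τt i) then (1 : ℝ) else 0))
      - (∑ i, (if y - t < -τt i ∧ -τt i ≤ y then (1 : ℝ) else 0)
            * (if y + τt i < ηt i then (1 : ℝ) else 0))
      + (∑ j, (if τ j ≤ t then (1 : ℝ) else 0))
      - (∑ j, (if τ j ≤ t then (1 : ℝ) else 0)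
            * (if η j ≤ min (t - τ j) y then (1 : ℝ) else 0))
      - ∑ j, (if τ j < t - y then (1 : ℝ) else 0) * (if y < η j then (1 : ℝ) else 0) := by
  have initial : ∀ i, (if t - τt i ≤ y then (1 : ℝ) else 0) * (if t < ηt i then (1 : ℝ) else 0)
      = (if -τt i ≤ y then (1 : ℝ) else 0)
        - (if ηt i ≤ min t (y + τt i) then (1 : ℝ) else 0)
        - (if y - t < -τt i ∧ -τt i ≤ y then (1 : ℝ) else 0)
            * (if y + τt i < ηt i then (1 : ℝ) else 0) := by
    intro i
    have := hηt i
    simp only [le_min_iff]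
    split_ifs <;> grind
  have arrival : ∀ j, (if τ j ≤ t then (1 : ℝ) else 0) * (if t - τ j ≤ y then (1 : ℝ) else 0)
          * (if t - τ j < η j then (1 : ℝ) else 0)
      = (if τ j ≤ t then (1 : ℝ) else 0)
        - (if τ j ≤ t then (1 : ℝ) else 0)
            * (if η j ≤ min (t - τ j) y then (1 : ℝ) else 0)
        - (if τ j < t - y then (1 : ℝ) else 0) * (if y < η j then (1 : ℝ) else 0) := by
    intro j
    simp only [le_min_iff]
    split_ifs <;> grind
  rw [sum_congr rfl fun i _ => initial i, sum_congr rfl fun j _ => arrival j]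
  simp only [sum_sub_distrib]
  ring
end

section
/- Let t ≥ 0 be a real number, consider age-model customer data as below, and let ψ : ℝ → ℝ be a continuous function. Then ∫_0^∞ ( ∑_{i=1}^N 1{−τ̃_i ≤ y ≤ min(η̃_i, t) − τ̃_i} + ∑_{j=1}^K 1{y ≤ η_j}·1{τ_j + y ≤ t} ) ψ(y) dy = ∫_0^t ( ∑_{i=1}^N 1{s ≤ η̃_i}·ψ(s−τ̃_i) + ∑_{j=1}^K 1{τ_j ≤ s ≤ τ_j+η_j}·ψ(s−τ_j) ) ds. (This is the key identity proved inside Proposition 2.3 of the paper with ψ = φ′; the left side is the Lebesgue integral of φ′ against the count of customers whose age exceeds y at time t but was at most y at time 0 resp. arrival, and the right side is ∫_0^t ⟨A_s, φ′⟩ ds.) -/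
open Finset MeasureTheory intervalIntegral

theorem integrableOn_Ioi_and_integral_eq_of_translate {f g : ℝ → ℝ} {c t : ℝ} (ht : 0 ≤ t)
    (h : ∀ y, (Set.Ici 0).indicator f y = (Set.Icc 0 t).indicator g (y + c))
    (hg : IntegrableOn g (Set.Icc 0 t)) :
    IntegrableOn f (Set.Ioi 0) ∧ ∫ y in Set.Ioi (0 : ℝ), f y = ∫ s in (0 : ℝ)..t, g s := by
  have hfun : (Set.Ici 0).indicator f = fun y => (Set.Icc 0 t).indicator g (y + c) := funext h
  constructor
  · rw [← integrableOn_Ici_iff_integrableOn_Ioi, ← integrable_indicator_iff measurableSet_Ici, hfun]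
    exact ((integrable_indicator_iff measurableSet_Icc).2 hg).comp_add_right c
  · rw [← integral_Ici_eq_integral_Ioi, integral_of_le ht, ← integral_Icc_eq_integral_Ioc,
      ← MeasureTheory.integral_indicator measurableSet_Ici,
      ← MeasureTheory.integral_indicator measurableSet_Icc, hfun]
    exact integral_add_right_eq_self _ c

theorem integrableOn_ite_mul_of_continuous {p : ℝ → Prop} [DecidablePred p] {ψ : ℝ → ℝ}
    (hp : MeasurableSet {s | p s}) (hψ : Continuous ψ) (a b : ℝ) :
    IntegrableOn (fun s => (if p s then (1 : ℝ) else 0) * ψ s) (Set.Icc a b) := by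
  have h : IntegrableOn ({s | p s}.indicator ψ) (Set.Icc a b) :=
    (hψ.integrableOn_Icc).indicator hp
  refine h.congr_fun (fun s _ => ?_) measurableSet_Icc
  by_cases hs : p s <;> simp [hs]

/-- The key identity inside Proposition 2.3 of the paper (with `ψ = φ′`): the Lebesgue integral
of `ψ` over `(0,∞)` against the count of customers whose age exceeds `y` at time `t` but was at
most `y` at time `0` (resp. at arrival) equals `∫_0^t ⟨A_s, ψ⟩ ds`. -/
theorem derivative_identity
    (N K : ℕ) (τt ηt : Fin N → ℝ) (τ η : Fin K → ℝ)
    (hτt : ∀ i, τt i ≤ 0) (hηt : ∀ i, 0 ≤ ηt i)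
    (hτ : ∀ j, 0 ≤ τ j) (hη : ∀ j, 0 ≤ η j)
    (t : ℝ) (ht : 0 ≤ t) (ψ : ℝ → ℝ) (hψ : Continuous ψ) :
    (∫ y in Set.Ioi (0 : ℝ),
        ((∑ i, (if -τt i ≤ y ∧ y ≤ min (ηt i) t - τt i then (1 : ℝ) else 0))
          + ∑ j, (if y ≤ η j then (1 : ℝ) else 0) * (if τ j + y ≤ t then (1 : ℝ) else 0))
          * ψ y)
    = ∫ s in (0 : ℝ)..t,
        ((∑ i, (if s ≤ ηt i then (1 : ℝ) else 0) * ψ (s - τt i))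
          + ∑ j, (if τ j ≤ s ∧ s ≤ τ j + η j then (1 : ℝ) else 0) * ψ (s - τ j)) := by
  have hgi : ∀ i, IntegrableOn (fun s => (if s ≤ ηt i then (1 : ℝ) else 0) * ψ (s - τt i))
      (Set.Icc 0 t) := fun i =>
    integrableOn_ite_mul_of_continuous measurableSet_Iic (hψ.comp (continuous_sub_right _)) 0 t
  have hgj : ∀ j, IntegrableOn
      (fun s => (if τ j ≤ s ∧ s ≤ τ j + η j then (1 : ℝ) else 0) * ψ (s - τ j))
      (Set.Icc 0 t) := fun j =>
    integrableOn_ite_mul_of_continuous measurableSet_Icc (hψ.comp (continuous_sub_right _)) 0 t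
  have hi := fun i => integrableOn_Ioi_and_integral_eq_of_translate
    (f := fun y => (if -τt i ≤ y ∧ y ≤ min (ηt i) t - τt i then (1 : ℝ) else 0) * ψ y)
    (c := τt i) ht (fun y => by
      have := hτt i
      simp only [Set.indicator_apply, Set.mem_Ici, Set.mem_Icc, add_sub_cancel_right,
        le_sub_iff_add_le, le_min_iff]
      grind) (hgi i)
  have hj := fun j => integrableOn_Ioi_and_integral_eq_of_translate
    (f := fun y => (if y ≤ η j then (1 : ℝ) else 0) * (if τ j + y ≤ t then (1 : ℝ) else 0) * ψ y)
    (c := τ j) ht (fun y => by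
      have := hτ j
      simp only [Set.indicator_apply, Set.mem_Ici, Set.mem_Icc, add_sub_cancel_right]
      grind) (hgj j)
  have hgi' := fun i => (intervalIntegrable_iff_integrableOn_Icc_of_le ht).2 (hgi i)
  have hgj' := fun j => (intervalIntegrable_iff_integrableOn_Icc_of_le ht).2 (hgj j)
  simp only [add_mul, Finset.sum_mul]
  rw [MeasureTheory.integral_add (integrable_finsetSum _ fun i _ => (hi i).1)
      (integrable_finsetSum _ fun j _ => (hj j).1),
    MeasureTheory.integral_finsetSum _ fun i _ => (hi i).1,
    MeasureTheory.integral_finsetSum _ fun j _ => (hj j).1,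
    intervalIntegral.integral_add ((intervalIntegrable_iff_integrableOn_Icc_of_le ht).2
        (integrable_finsetSum _ fun i _ => hgi i))
      ((intervalIntegrable_iff_integrableOn_Icc_of_le ht).2
        (integrable_finsetSum _ fun j _ => hgj j)),
    intervalIntegral.integral_finsetSum fun i _ => hgi' i,
    intervalIntegral.integral_finsetSum fun j _ => hgj' j]
  simp only [(hi _).2, (hj _).2]
end

section
/- Let F̄ : ℝ → ℝ satisfy F̄(x) > 0 for all x ≥ 0 and be nonincreasing on [0,∞) (i.e., 0 ≤ u ≤ v implies F̄(v) ≤ F̄(u)), let ψ : ℝ → ℝ be measurable, and let t ≥ 0. Then ∫_0^∞ ( (F̄(x+t)/F̄(x)) · ψ(x+t) )² · F̄(x) dx ≤ ∫_0^∞ ψ(x)² · F̄(x) dx, where both sides are Lebesgue integrals of nonnegative functions (the inequality holding in [0,∞]). (This is the key L²(μ) contraction estimate in the proof of Proposition 3.1 of the paper, where μ is the measure on [0,∞) with density F̄; it shows each term ‖(F̄(·+t)/F̄)·φ^{(i)}(·+t)‖_{L²} is at most ‖φ^{(i)}‖_{L²}, giving the (C₀,1)-semigroup bound for the age semigroup.)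 -/
open MeasureTheory

/-- The key `L²(μ)` contraction estimate in the proof of Proposition 3.1 of the paper, where
`μ` is the measure on `[0,∞)` with density `F̄`: for `t ≥ 0`,
`‖(F̄(·+t)/F̄)·ψ(·+t)‖_{L²(μ)} ≤ ‖ψ‖_{L²(μ)}`. -/
theorem age_semigroup_L2_contraction
    (Fbar : ℝ → ℝ) (hpos : ∀ x : ℝ, 0 ≤ x → 0 < Fbar x)
    (hmono : ∀ u v : ℝ, 0 ≤ u → u ≤ v → Fbar v ≤ Fbar u)
    (ψ : ℝ → ℝ) (hψ : Measurable ψ) (t : ℝ) (ht : 0 ≤ t) :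
    (∫⁻ x in Set.Ioi (0 : ℝ),
        ENNReal.ofReal (((Fbar (x + t) / Fbar x) * ψ (x + t)) ^ 2 * Fbar x))
      ≤ ∫⁻ x in Set.Ioi (0 : ℝ), ENNReal.ofReal (ψ x ^ 2 * Fbar x) := by
  have shift : ∫⁻ x in Set.Ioi (0 : ℝ), ENNReal.ofReal (ψ (x + t) ^ 2 * Fbar (x + t))
      = ∫⁻ x in Set.Ioi t, ENNReal.ofReal (ψ x ^ 2 * Fbar x) := by
    have h := (measurePreserving_add_right volume t).setLIntegral_comp_preimage_emb
      (measurableEmbedding_addRight t) (fun x => ENNReal.ofReal (ψ x ^ 2 * Fbar x)) (Set.Ioi t)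
    simpa using h
  calc
    _ ≤ ∫⁻ x in Set.Ioi (0 : ℝ), ENNReal.ofReal (ψ (x + t) ^ 2 * Fbar (x + t)) := by
      refine setLIntegral_mono' measurableSet_Ioi fun x hx => ENNReal.ofReal_le_ofReal ?_
      have hx : 0 ≤ x := le_of_lt hx
      have hFx := hpos x hx
      have hFxt := hpos (x + t) (by linarith)
      have hratio : Fbar (x + t) / Fbar x ≤ 1 :=
        (div_le_one hFx).2 (hmono x (x + t) hx (by linarith))
      calc
        _ = ψ (x + t) ^ 2 * Fbar (x + t) * (Fbar (x + t) / Fbar x) := by field_simp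
        _ ≤ _ := mul_le_of_le_one_right (by positivity) hratio
    _ = ∫⁻ x in Set.Ioi t, ENNReal.ofReal (ψ x ^ 2 * Fbar x) := shift
    _ ≤ _ := lintegral_mono_set (Set.Ioi_subset_Ioi ht)
end

section
/- Let F̄ : ℝ → ℝ be measurable with 0 ≤ F̄(x) ≤ 1 for all x ≥ 0 and nonincreasing on [0,∞) (i.e., 0 ≤ u ≤ v implies F̄(v) ≤ F̄(u)), let ψ : ℝ → ℝ be measurable, and let t ≥ 0. Then ∫_{−∞}^0 ψ(x−t)² dx + ∫_0^∞ ψ(x−t)² F̄(x) dx ≤ ∫_{−∞}^0 ψ(x)² dx + ∫_0^∞ ψ(x)² F̄(x) dx, where all integrals are Lebesgue integrals of nonnegative functions (the inequality holding in [0,∞]). (This is the key estimate ‖ψ(·−t)‖_{L²(μ)} ≤ ‖ψ‖_{L²(μ)} in the proof of Proposition 3.2 of the paper, showing the translation semigroup (τ_t) is a (C₀,1)-semigroup on the Sobolev space built from the measure μ = μ_- + μ_+.) -/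
open MeasureTheory

/-- The density of `μ` with respect to Lebesgue measure: `1` on `(-∞, 0]` and `F` on `(0, ∞)`. -/
noncomputable def halfLineWeight (F : ℝ → ℝ) (x : ℝ) : ℝ :=
  if x ≤ 0 then 1 else F x

theorem lintegral_Iic_add_lintegral_Ioi_eq (F φ : ℝ → ℝ) :
    (∫⁻ x in Set.Iic (0 : ℝ), ENNReal.ofReal (φ x))
        + (∫⁻ x in Set.Ioi (0 : ℝ), ENNReal.ofReal (φ x * F x))
      = ∫⁻ x, ENNReal.ofReal (φ x * halfLineWeight F x) := by
  rw [← lintegral_add_compl (fun x => ENNReal.ofReal (φ x * halfLineWeight F x))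
    (measurableSet_Iic (a := (0 : ℝ))), Set.compl_Iic]
  congr 1
  · refine setLIntegral_congr_fun measurableSet_Iic fun x hx => ?_
    simp [halfLineWeight, Set.mem_Iic.mp hx]
  · refine setLIntegral_congr_fun measurableSet_Ioi fun x hx => ?_
    simp [halfLineWeight, not_le.mpr (Set.mem_Ioi.mp hx)]

theorem antitone_halfLineWeight {F : ℝ → ℝ} (hF : ∀ x : ℝ, 0 ≤ x → F x ≤ 1)
    (hmono : ∀ u v : ℝ, 0 ≤ u → u ≤ v → F v ≤ F u) : Antitone (halfLineWeight F) := by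
  intro u v huv
  unfold halfLineWeight
  split_ifs with hv hu hu
  · exact le_rfl
  · exact absurd (huv.trans hv) hu
  · exact hF v (not_le.mp hv).le
  · exact hmono u v (not_le.mp hu).le huv

/-- The key estimate `‖ψ(·−t)‖_{L²(μ)} ≤ ‖ψ‖_{L²(μ)}` in the proof of Proposition 3.2 of the
paper, where `μ` is Lebesgue measure on `(−∞,0]` plus the measure with density `F̄` on `[0,∞)`;
it shows the translation semigroup is a `(C₀,1)`-semigroup on the associated Sobolev space. -/
theorem translation_semigroup_L2_contraction
    (Fbar : ℝ → ℝ) (hFbar : Measurable Fbar)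
    (hrange : ∀ x : ℝ, 0 ≤ x → 0 ≤ Fbar x ∧ Fbar x ≤ 1)
    (hmono : ∀ u v : ℝ, 0 ≤ u → u ≤ v → Fbar v ≤ Fbar u)
    (ψ : ℝ → ℝ) (hψ : Measurable ψ) (t : ℝ) (ht : 0 ≤ t) :
    (∫⁻ x in Set.Iic (0 : ℝ), ENNReal.ofReal (ψ (x - t) ^ 2))
        + (∫⁻ x in Set.Ioi (0 : ℝ), ENNReal.ofReal (ψ (x - t) ^ 2 * Fbar x))
      ≤ (∫⁻ x in Set.Iic (0 : ℝ), ENNReal.ofReal (ψ x ^ 2))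
        + ∫⁻ x in Set.Ioi (0 : ℝ), ENNReal.ofReal (ψ x ^ 2 * Fbar x) := by
  rw [lintegral_Iic_add_lintegral_Ioi_eq Fbar (fun x => ψ (x - t) ^ 2),
    lintegral_Iic_add_lintegral_Ioi_eq Fbar (fun x => ψ x ^ 2),
    ← lintegral_sub_right_eq_self
      (fun x => ENNReal.ofReal (ψ x ^ 2 * halfLineWeight Fbar x)) t]
  refine lintegral_mono fun x => ENNReal.ofReal_le_ofReal ?_
  exact mul_le_mul_of_nonneg_left
    (antitone_halfLineWeight (fun y hy => (hrange y hy).2) hmono (sub_le_self x ht))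
    (sq_nonneg _)
end

section
/- Let F̄ : ℝ → ℝ be differentiable on [0,∞) with F̄(0) = 1, F̄(y) > 0 for all y ≥ 0, and derivative F̄′(y) = −f(y) for y ≥ 0, and set h := f/F̄. Let λ > 0, and let φ : ℝ → ℝ be differentiable with continuous derivative such that y ↦ f(y)φ(y) and y ↦ F̄(y)φ′(y) are integrable on (0,∞) and F̄(y)φ(y) → 0 as y → ∞. Then λ·∫_0^∞ ( h(y)φ(y) − φ′(y) ) F̄(y) dy = λ·φ(0); equivalently, ∫_0^∞ ( f(y)φ(y) − F̄(y)φ′(y) ) dy = φ(0). Consequently, for every t ≥ 0, λ∫_0^∞ φ F̄ dy = λ∫_0^∞ φ F̄ dy + λ t φ(0) − ∫_0^t ( λ∫_0^∞ h φ F̄ dy ) ds + ∫_0^t ( λ∫_0^∞ φ′ F̄ dy ) ds, i.e., the constant path t ↦ λ𝓕_e, where 𝓕_e is the measure on [0,∞) with density F̄, is a stationary solution of the fluid-limit equation ⟨𝒜̄_t, φ⟩ = ⟨𝒜̄_0, φ⟩ + Ē_t φ(0) − ∫_0^t ⟨𝒜̄_s, hφ⟩ ds + ∫_0^t ⟨𝒜̄_s,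 φ′⟩ ds with Ē_t = λt. (This is Proposition 7.1 of the paper.) -/
open MeasureTheory intervalIntegral

/-- Proposition 7.1 of the paper: with `Ē_t = λt`, the constant path `t ↦ λ𝓕_e` (where `𝓕_e`
has density `F̄` on `[0,∞)`) is a stationary solution of the fluid-limit equation
`⟨𝒜̄_t, φ⟩ = ⟨𝒜̄_0, φ⟩ + Ē_t φ(0) − ∫_0^t ⟨𝒜̄_s, hφ⟩ ds + ∫_0^t ⟨𝒜̄_s, φ′⟩ ds`, via the key
identity `λ∫_0^∞ (hφ − φ′) F̄ dy = λφ(0)`. -/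
theorem stationary_fluid_solution
    (Fbar f h : ℝ → ℝ)
    (hderiv : ∀ y : ℝ, 0 ≤ y → HasDerivAt Fbar (-f y) y)
    (hF0 : Fbar 0 = 1) (hpos : ∀ y : ℝ, 0 ≤ y → 0 < Fbar y)
    (hh : ∀ y, h y = f y / Fbar y)
    (lam : ℝ) (hlam : 0 < lam)
    (φ : ℝ → ℝ) (hφ : Differentiable ℝ φ) (hφ' : Continuous (deriv φ))
    (hint1 : IntegrableOn (fun y => f y * φ y) (Set.Ioi (0 : ℝ)))
    (hint2 : IntegrableOn (fun y => Fbar y * deriv φ y) (Set.Ioi (0 : ℝ)))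
    (hlim : Filter.Tendsto (fun y => Fbar y * φ y) Filter.atTop (nhds 0)) :
    (lam * ∫ y in Set.Ioi (0 : ℝ), (h y * φ y - deriv φ y) * Fbar y = lam * φ 0) ∧
      ((∫ y in Set.Ioi (0 : ℝ), (f y * φ y - Fbar y * deriv φ y)) = φ 0) ∧
      ∀ t : ℝ, 0 ≤ t →
        lam * ∫ y in Set.Ioi (0 : ℝ), φ y * Fbar y
          = (lam * ∫ y in Set.Ioi (0 : ℝ), φ y * Fbar y) + lam * t * φ 0
            - (∫ s in (0 : ℝ)..t, lam * ∫ y in Set.Ioi (0 : ℝ), h y * φ y * Fbar y)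
            + ∫ s in (0 : ℝ)..t, lam * ∫ y in Set.Ioi (0 : ℝ), deriv φ y * Fbar y := by
  have hparts : (∫ y in Set.Ioi (0 : ℝ), (f y * φ y - Fbar y * deriv φ y)) = φ 0 := by
    have key := integral_Ioi_of_hasDerivAt_of_tendsto' (a := (0 : ℝ))
      (f := fun y => -(Fbar y * φ y)) (f' := fun y => f y * φ y - Fbar y * deriv φ y) (m := 0)
      (fun y hy => by
        refine ((hderiv y hy).mul (hφ y).hasDerivAt).neg.congr_deriv ?_
        ring)
      (hint1.sub hint2) (by simpa using hlim.neg)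
    simpa [hF0] using key
  have hhazard : ∀ y ∈ Set.Ioi (0 : ℝ), h y * φ y * Fbar y = f y * φ y := fun y hy => by
    have := (hpos y (le_of_lt hy)).ne'
    rw [hh]
    field_simp
  have hdiff : (∫ y in Set.Ioi (0 : ℝ), h y * φ y * Fbar y)
      - (∫ y in Set.Ioi (0 : ℝ), deriv φ y * Fbar y) = φ 0 := by
    rw [setIntegral_congr_fun measurableSet_Ioi hhazard, ← hparts,
      integral_sub hint1 hint2]
    simp only [mul_comm]
  refine ⟨?_, hparts, fun t _ => ?_⟩
  · rw [← hparts]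
    congr 1
    refine setIntegral_congr_fun measurableSet_Ioi fun y hy => ?_
    simp only [sub_mul, hhazard y hy, mul_comm (deriv φ y)]
  · simp only [intervalIntegral.integral_const, smul_eq_mul, sub_zero]
    rw [← hdiff]
    ring
end

section
/- Let F : [0,∞) → ℝ be differentiable with continuous derivative f, with F(0) = 0, and set F̄ := 1 − F. Let λ, σ ∈ ℝ and let φ : ℝ → ℝ be differentiable with continuous derivative such that φ(x)²·(λF(x) + σ²F̄(x))·F̄(x) → 0 as x → ∞ and the functions x ↦ φ(x)φ′(x)(λF(x)+σ²F̄(x))F̄(x), x ↦ φ(x)²f(x)(λF(x)+σ²F̄(x)), and x ↦ φ(x)²f(x) are integrable on (0,∞). Then ∫_0^∞ ( f(x)·φ(x)² − φ(x)·φ′(x)·F̄(x) ) · ( λF(x) + σ²F̄(x) ) dx = (σ²/2)·φ(0)² + (λ/2)·∫_0^∞ φ(x)²·f(x) dx. (This is the integration-by-parts identity, equations (generator1)–(generator2) in the proof of Proposition 7.3 of the paper, which verifies that the centered Gaussian law with covariance E[⟨𝒜̂_∞,φ⟩⟨𝒜̂_∞,ψ⟩] = ⟨𝓕_e, (λF+σ²F̄)φψ⟩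 satisfies the basic adjoint relationship for the limiting Ornstein–Uhlenbeck generator; note f φ² = h φ² F̄ with h the hazard rate.) -/
open MeasureTheory

/-- The integration-by-parts identity (equations (generator1)–(generator2)) in the proof of
Proposition 7.3 of the paper, verifying that the centered Gaussian law with covariance
`⟨𝓕_e, (λF+σ²F̄)φψ⟩` satisfies the basic adjoint relationship for the limiting
Ornstein–Uhlenbeck generator. -/
theorem stationary_bar_identity
    (F f Fbar : ℝ → ℝ)
    (hderiv : ∀ x : ℝ, 0 ≤ x → HasDerivAt F (f x) x)
    (hfcont : ContinuousOn f (Set.Ici (0 : ℝ)))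
    (hF0 : F 0 = 0) (hFbar : ∀ x, Fbar x = 1 - F x)
    (lam sigma : ℝ)
    (φ : ℝ → ℝ) (hφ : Differentiable ℝ φ) (hφ' : Continuous (deriv φ))
    (hlim : Filter.Tendsto
      (fun x => φ x ^ 2 * (lam * F x + sigma ^ 2 * Fbar x) * Fbar x)
      Filter.atTop (nhds 0))
    (hint1 : IntegrableOn
      (fun x => φ x * deriv φ x * (lam * F x + sigma ^ 2 * Fbar x) * Fbar x)
      (Set.Ioi (0 : ℝ)))
    (hint2 : IntegrableOn
      (fun x => φ x ^ 2 * f x * (lam * F x + sigma ^ 2 * Fbar x))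
      (Set.Ioi (0 : ℝ)))
    (hint3 : IntegrableOn (fun x => φ x ^ 2 * f x) (Set.Ioi (0 : ℝ))) :
    (∫ x in Set.Ioi (0 : ℝ),
        (f x * φ x ^ 2 - φ x * deriv φ x * Fbar x) * (lam * F x + sigma ^ 2 * Fbar x))
      = sigma ^ 2 / 2 * φ 0 ^ 2
        + lam / 2 * ∫ x in Set.Ioi (0 : ℝ), φ x ^ 2 * f x := by
  obtain rfl : Fbar = fun x => 1 - F x := funext hFbar
  have hG : ∀ x ∈ Set.Ici (0 : ℝ), HasDerivAt
      (fun x => φ x ^ 2 * (lam * F x + sigma ^ 2 * (1 - F x)) * (1 - F x))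
      (2 * (φ x * deriv φ x * (lam * F x + sigma ^ 2 * (1 - F x)) * (1 - F x))
        + lam * (φ x ^ 2 * f x)
        - 2 * (φ x ^ 2 * f x * (lam * F x + sigma ^ 2 * (1 - F x)))) x := by
    intro x hx
    have hF := hderiv x hx
    have hB := hF.const_sub 1
    have hL := (hF.const_mul lam).add (hB.const_mul (sigma ^ 2))
    refine (((((hφ x).hasDerivAt.pow 2).mul hL).mul hB).congr_deriv ?_)
    simp
    ring
  have hint : IntegrableOn (fun x =>
      2 * (φ x * deriv φ x * (lam * F x + sigma ^ 2 * (1 - F x)) * (1 - F x))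
        + lam * (φ x ^ 2 * f x)
        - 2 * (φ x ^ 2 * f x * (lam * F x + sigma ^ 2 * (1 - F x)))) (Set.Ioi 0) :=
    ((hint1.const_mul 2).add (hint3.const_mul lam)).sub (hint2.const_mul 2)
  have hFTC := integral_Ioi_of_hasDerivAt_of_tendsto' hG hint hlim
  have hsplit : ∀ x, (f x * φ x ^ 2 - φ x * deriv φ x * (1 - F x))
        * (lam * F x + sigma ^ 2 * (1 - F x))
      = lam / 2 * (φ x ^ 2 * f x)
        - 1 / 2 * (2 * (φ x * deriv φ x * (lam * F x + sigma ^ 2 * (1 - F x)) * (1 - F x))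
          + lam * (φ x ^ 2 * f x)
          - 2 * (φ x ^ 2 * f x * (lam * F x + sigma ^ 2 * (1 - F x)))) := by
    intro x
    ring
  simp only [hsplit]
  rw [integral_sub (hint3.const_mul (lam / 2)) (hint.const_mul (1 / 2)),
    integral_const_mul, integral_const_mul, hFTC, hF0]
  ring
end
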